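/- Let n ≥ 1 and let ω : ℝⁿ → ℝ be a measurable function, positive almost everywhere, satisfying the A₂ condition with constant C; write μ_ω for the measure with density ω. Let x₀ ∈ ℝⁿ and 0 < R' < R, and let (u_j) be a sequence of continuously differentiable functions on ℝⁿ such that ∫_{B(x₀,R)} (u_j² + ‖∇u_j‖²) dμ_ω ≤ 1 for every j. Then there exists a subsequence (u_{j_l}) that converges in L²(B(x₀,R'), μ_ω), i.e., there is a measurable function u with ∫_{B(x₀,R')} |u_{j_l} − u|² dμ_ω → 0 as l → ∞. -/

import Mathlib

open MeasureTheory Metric NNReal ENNReal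

/-- `ω` satisfies the Muckenhoupt `A₂` condition with constant `C` on `ℝⁿ`:
for every metric ball `B` of positive radius,
`(⨍_B ω) · (⨍_B ω⁻¹) ≤ C`, stated equivalently (multiplying through by `vol(B)²`)
as `(∫_B ω) · (∫_B ω⁻¹) ≤ C · vol(B)²`, with integrals in `[0,∞]`. -/
def IsA2 (n : ℕ) (ω : EuclideanSpace ℝ (Fin n) → ℝ) (C : ℝ≥0∞) : Prop :=
  ∀ (x : EuclideanSpace ℝ (Fin n)) (r : ℝ), 0 < r →
    (∫⁻ y in ball x r, ENNReal.ofReal (ω y)) *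
      (∫⁻ y in ball x r, ENNReal.ofReal (ω y)⁻¹) ≤
      C * (volume (ball x r)) ^ 2

/-- The measure `μ_ω` with density `ω` with respect to Lebesgue measure. -/
noncomputable def muOmega (n : ℕ) (ω : EuclideanSpace ℝ (Fin n) → ℝ) :
    Measure (EuclideanSpace ℝ (Fin n)) :=
  volume.withDensity (fun x => ENNReal.ofReal (ω x))

lemma lintegral_ball_comp_lineMap {n : ℕ} {G : EuclideanSpace ℝ (Fin n) → ℝ≥0∞}
    (hG : Measurable G) (x p : EuclideanSpace ℝ (Fin n)) (ε : ℝ) {t : ℝ} (ht : 0 < t) :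
    ∫⁻ z in ball (x + t • (p - x)) (t * ε), G z
      = ENNReal.ofReal (t ^ n) * ∫⁻ y in ball p ε, G (x + t • (y - x)) := by
  have hmem : ∀ y, x + t • (y - x) ∈ ball (x + t • (p - x)) (t * ε) ↔ y ∈ ball p ε := by
    intro y
    rw [mem_ball, mem_ball, dist_add_left, dist_smul₀, dist_sub_right, Real.norm_eq_abs,
      abs_of_pos ht, mul_lt_mul_iff_right₀ ht]
  have hF : Measurable ((ball (x + t • (p - x)) (t * ε)).indicator G) :=
    hG.indicator measurableSet_ball
  have key : ∫⁻ y, (ball (x + t • (p - x)) (t * ε)).indicator G (x + t • (y - x))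
      = ENNReal.ofReal (t ^ n)⁻¹ *
        ∫⁻ z, (ball (x + t • (p - x)) (t * ε)).indicator G z := by
    have h1 := Measure.map_addHaar_smul (volume : Measure (EuclideanSpace ℝ (Fin n))) ht.ne'
    have h2 : ∫⁻ y, (ball (x + t • (p - x)) (t * ε)).indicator G (x + t • (y - x))
        = ∫⁻ y, (ball (x + t • (p - x)) (t * ε)).indicator G (x + t • y) :=
      lintegral_sub_right_eq_self
        (fun y => (ball (x + t • (p - x)) (t * ε)).indicator G (x + t • y)) x
    have h3 : ∫⁻ y, (ball (x + t • (p - x)) (t * ε)).indicator G (x + t • y)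
        = ∫⁻ y, (ball (x + t • (p - x)) (t * ε)).indicator G (x + y)
          ∂(Measure.map (fun y => t • y) volume) :=
      (lintegral_map (hF.comp (measurable_const_add x)) (measurable_const_smul t)).symm
    rw [h2, h3, h1, lintegral_smul_measure, lintegral_add_left_eq_self, finrank_euclideanSpace_fin,
      abs_of_pos (by positivity), smul_eq_mul]
  rw [lintegral_indicator measurableSet_ball] at key
  have h4 : ∫⁻ y, (ball (x + t • (p - x)) (t * ε)).indicator G (x + t • (y - x))
      = ∫⁻ y in ball p ε, G (x + t • (y - x)) := by
    rw [← lintegral_indicator measurableSet_ball]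
    congr 1 with y
    by_cases hy : y ∈ ball p ε
    · rw [Set.indicator_of_mem hy, Set.indicator_of_mem ((hmem y).2 hy)]
    · rw [Set.indicator_of_notMem hy, Set.indicator_of_notMem (mt (hmem y).1 hy)]
  rw [← h4, key, ← mul_assoc, ← ENNReal.ofReal_mul (by positivity),
    mul_inv_cancel₀ (by positivity), ENNReal.ofReal_one, one_mul]

lemma volume_ball_mul {n : ℕ} (x y : EuclideanSpace ℝ (Fin n)) (r : ℝ) {t : ℝ} (ht : 0 < t) :
    volume (ball y (t * r)) = ENNReal.ofReal (t ^ n) * volume (ball x r) := by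
  rw [Measure.addHaar_ball_mul_of_pos _ _ ht, finrank_euclideanSpace_fin,
    Measure.addHaar_ball_center _ x]

lemma enorm_sub_le_lintegral_fderiv_segment {n : ℕ} {u : EuclideanSpace ℝ (Fin n) → ℝ}
    (hu : ContDiff ℝ 1 u) (x y : EuclideanSpace ℝ (Fin n)) :
    ‖u y - u x‖ₑ ≤ ∫⁻ t in Set.Ioc (0 : ℝ) 1, ‖fderiv ℝ u (x + t • (y - x))‖ₑ * ‖y - x‖ₑ := by
  have hγ : ContDiff ℝ 1 (fun t : ℝ => u (x + t • (y - x))) := by fun_prop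
  have h := enorm_sub_le_lintegral_deriv_of_contDiffOn_Icc (hγ.contDiffOn (s := Set.Icc 0 1))
    zero_le_one
  simp only [one_smul, zero_smul, add_zero, add_sub_cancel] at h
  refine h.trans ?_
  rw [restrict_Ioc_eq_restrict_Icc]
  refine lintegral_mono fun t => ?_
  have h1 : HasDerivAt (fun t : ℝ => x + t • (y - x)) (y - x) t := by
    simpa using ((hasDerivAt_id t).smul_const (y - x)).const_add x
  have h2 := ((hu.differentiable one_ne_zero) (x + t • (y - x))).hasFDerivAt.comp_hasDerivAt t h1
  have h3 : deriv (fun t : ℝ => u (x + t • (y - x))) t = fderiv ℝ u (x + t • (y - x)) (y - x) :=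
    h2.deriv
  rw [h3]
  exact ContinuousLinearMap.le_opENorm _ _

lemma enorm_sub_setAverage_mul_le {n : ℕ} {u : EuclideanSpace ℝ (Fin n) → ℝ}
    (hu : Continuous u) (x p : EuclideanSpace ℝ (Fin n)) {ε : ℝ} (hε : 0 < ε) :
    ‖u x - ⨍ y in ball p ε, u y‖ₑ * volume (ball p ε) ≤ ∫⁻ y in ball p ε, ‖u y - u x‖ₑ := by
  have hint : IntegrableOn u (ball p ε) :=
    (hu.continuousOn.integrableOn_compact (isCompact_closedBall p ε)).mono_set
      ball_subset_closedBall
  have hV : volume (ball p ε) ≠ ∞ := measure_ball_lt_top.ne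
  have hV0 : volume (ball p ε) ≠ 0 := (measure_ball_pos _ _ hε).ne'
  have h1 : (u x - ⨍ y in ball p ε, u y) * volume.real (ball p ε)
      = - ∫ y in ball p ε, (u y - u x) := by
    have h0 : volume.real (ball p ε) ≠ 0 := (ENNReal.toReal_pos hV0 hV).ne'
    rw [integral_sub hint (integrableOn_const hV), setAverage_eq, setIntegral_const]
    simp only [smul_eq_mul]
    field_simp
    ring
  have h2 : ‖u x - ⨍ y in ball p ε, u y‖ₑ * volume (ball p ε)
      = ‖∫ y in ball p ε, (u y - u x)‖ₑ := by
    rw [← enorm_neg (∫ y in ball p ε, (u y - u x)), ← h1, enorm_mul]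
    congr 1
    rw [Real.enorm_of_nonneg measureReal_nonneg, ofReal_measureReal hV]
  rw [h2]
  exact enorm_integral_le_lintegral_enorm _

lemma exists_enorm_sub_setAverage_le {n : ℕ} {u : EuclideanSpace ℝ (Fin n) → ℝ}
    (hu : ContDiff ℝ 1 u) {x p : EuclideanSpace ℝ (Fin n)} {ε : ℝ} (hε : 0 < ε)
    (hx : x ∈ ball p ε) :
    ∃ t ∈ Set.Ioc (0 : ℝ) 1,
      ‖u x - ⨍ y in ball p ε, u y‖ₑ * volume (ball (x + t • (p - x)) (t * ε)) ≤
        ENNReal.ofReal (2 * ε) *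
          ∫⁻ z in ball (x + t • (p - x)) (t * ε), ‖fderiv ℝ u z‖ₑ := by
  have hfd : Continuous (fderiv ℝ u) := hu.continuous_fderiv one_ne_zero
  have hG : Measurable fun z => ‖fderiv ℝ u z‖ₑ := hfd.enorm.measurable
  set D := ‖u x - ⨍ y in ball p ε, u y‖ₑ with hD
  set F : ℝ → ℝ≥0∞ := fun t =>
    ∫⁻ y in ball p ε, ‖fderiv ℝ u (x + t • (y - x))‖ₑ * ENNReal.ofReal (2 * ε) with hF
  suffices h : ∃ t ∈ Set.Ioc (0 : ℝ) 1, D * volume (ball p ε) ≤ F t by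
    obtain ⟨t, ht, h⟩ := h
    refine ⟨t, ht, ?_⟩
    rw [lintegral_ball_comp_lineMap hG x p ε ht.1, volume_ball_mul p _ ε ht.1]
    have h5 : F t = (∫⁻ y in ball p ε, ‖fderiv ℝ u (x + t • (y - x))‖ₑ)
        * ENNReal.ofReal (2 * ε) := lintegral_mul_const' _ _ ENNReal.ofReal_ne_top
    rw [h5] at h
    calc D * (ENNReal.ofReal (t ^ n) * volume (ball p ε))
        = ENNReal.ofReal (t ^ n) * (D * volume (ball p ε)) := by ring
      _ ≤ _ := mul_le_mul_right h _
      _ = _ := by ring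
  have hle : D * volume (ball p ε) ≤ ∫⁻ t in Set.Ioc (0 : ℝ) 1, F t := by
    refine (enorm_sub_setAverage_mul_le hu.continuous x p hε).trans ?_
    have hswap : ∫⁻ t in Set.Ioc (0 : ℝ) 1, F t = ∫⁻ y in ball p ε, ∫⁻ t in Set.Ioc (0 : ℝ) 1,
        ‖fderiv ℝ u (x + t • (y - x))‖ₑ * ENNReal.ofReal (2 * ε) := by
      refine lintegral_lintegral_swap ?_
      have : Continuous fun q : ℝ × EuclideanSpace ℝ (Fin n) =>
          fderiv ℝ u (x + q.1 • (q.2 - x)) := hfd.comp (by fun_prop)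
      exact (this.enorm.measurable.mul_const _).aemeasurable
    rw [hswap]
    refine setLIntegral_mono' measurableSet_ball fun y hy => ?_
    refine (enorm_sub_le_lintegral_fderiv_segment hu x y).trans (lintegral_mono fun t => ?_)
    refine mul_le_mul_right ?_ _
    rw [← ofReal_norm]
    refine ENNReal.ofReal_le_ofReal ?_
    rw [← dist_eq_norm]
    rw [mem_ball] at hx hy
    linarith [dist_triangle_right y x p]
  by_contra! hlt
  have hfin : D * volume (ball p ε) ≠ ∞ :=
    ENNReal.mul_ne_top enorm_ne_top measure_ball_lt_top.ne
  have hF1 : ∫⁻ t in Set.Ioc (0 : ℝ) 1, F t ≠ ∞ := by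
    refine ne_top_of_le_ne_top hfin ?_
    calc ∫⁻ t in Set.Ioc (0 : ℝ) 1, F t
        ≤ ∫⁻ t in Set.Ioc (0 : ℝ) 1, D * volume (ball p ε) :=
          setLIntegral_mono' measurableSet_Ioc fun t ht => (hlt t ht).le
      _ = D * volume (ball p ε) := by simp
  obtain ⟨t, ht, h⟩ := exists_setLAverage_le (μ := volume) (s := Set.Ioc (0 : ℝ) 1) (f := F)
    (by simp) measurableSet_Ioc.nullMeasurableSet hF1
  rw [setLAverage_eq] at h
  simp only [Real.volume_Ioc, sub_zero, ENNReal.ofReal_one, div_one] at h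
  exact absurd (hle.trans h) (not_le.2 (hlt t ht))

lemma sq_lintegral_mul_le {α : Type*} [MeasurableSpace α] (μ : Measure α) {f g : α → ℝ≥0∞}
    (hf : AEMeasurable f μ) (hg : AEMeasurable g μ) :
    (∫⁻ a, f a * g a ∂μ) ^ 2 ≤ (∫⁻ a, f a ^ 2 ∂μ) * ∫⁻ a, g a ^ 2 ∂μ := by
  have h := ENNReal.lintegral_mul_le_Lp_mul_Lq μ (p := 2) (q := 2)
    ⟨by norm_num, by norm_num, by norm_num⟩ hf hg
  simp only [Pi.mul_apply, ENNReal.rpow_two] at h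
  calc (∫⁻ a, f a * g a ∂μ) ^ 2
      ≤ ((∫⁻ a, f a ^ 2 ∂μ) ^ (1 / 2 : ℝ) * (∫⁻ a, g a ^ 2 ∂μ) ^ (1 / 2 : ℝ)) ^ 2 := by gcongr
    _ = _ := by
      rw [mul_pow, ← ENNReal.rpow_two, ← ENNReal.rpow_two, ← ENNReal.rpow_mul, ← ENNReal.rpow_mul]
      norm_num

lemma setLIntegral_muOmega {n : ℕ} {ω : EuclideanSpace ℝ (Fin n) → ℝ} (hmeas : Measurable ω)
    {f : EuclideanSpace ℝ (Fin n) → ℝ≥0∞} (hf : Measurable f)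
    {s : Set (EuclideanSpace ℝ (Fin n))} (hs : MeasurableSet s) :
    ∫⁻ x in s, f x ∂(muOmega n ω) = ∫⁻ x in s, ENNReal.ofReal (ω x) * f x := by
  rw [muOmega, restrict_withDensity hs,
    lintegral_withDensity_eq_lintegral_mul _ hmeas.ennreal_ofReal hf]
  rfl

lemma sq_setLIntegral_le_mul {n : ℕ} {ω : EuclideanSpace ℝ (Fin n) → ℝ} (hmeas : Measurable ω)
    (hpos : ∀ᵐ x ∂(volume : Measure (EuclideanSpace ℝ (Fin n))), 0 < ω x)
    {g : EuclideanSpace ℝ (Fin n) → ℝ≥0∞} (hg : Measurable g)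
    {s : Set (EuclideanSpace ℝ (Fin n))} (hs : MeasurableSet s) :
    (∫⁻ x in s, g x) ^ 2 ≤
      (∫⁻ x in s, g x ^ 2 ∂(muOmega n ω)) * ∫⁻ x in s, ENNReal.ofReal (ω x)⁻¹ := by
  have h1 : ∫⁻ x in s, g x = ∫⁻ x in s,
      (ENNReal.ofReal √(ω x) * g x) * ENNReal.ofReal (√(ω x))⁻¹ := by
    refine lintegral_congr_ae (ae_restrict_of_ae ?_)
    filter_upwards [hpos] with x hx
    have : 0 < √(ω x) := Real.sqrt_pos.2 hx
    rw [mul_right_comm, ← ENNReal.ofReal_mul this.le, mul_inv_cancel₀ this.ne', ENNReal.ofReal_one,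
      one_mul]
  rw [h1]
  refine (sq_lintegral_mul_le _ (by fun_prop) (by fun_prop)).trans_eq ?_
  rw [setLIntegral_muOmega hmeas (hg.pow_const 2) hs]
  congr 1
  · refine lintegral_congr_ae (ae_restrict_of_ae ?_)
    filter_upwards [hpos] with x hx
    rw [mul_pow, ← ENNReal.ofReal_pow (Real.sqrt_nonneg _), Real.sq_sqrt hx.le]
  · refine lintegral_congr_ae (ae_restrict_of_ae ?_)
    filter_upwards [hpos] with x hx
    rw [← ENNReal.ofReal_pow (by positivity), inv_pow, Real.sq_sqrt hx.le]

lemma muOmega_apply {n : ℕ} (ω : EuclideanSpace ℝ (Fin n) → ℝ)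
    {s : Set (EuclideanSpace ℝ (Fin n))} (hs : MeasurableSet s) :
    muOmega n ω s = ∫⁻ x in s, ENNReal.ofReal (ω x) :=
  withDensity_apply _ hs

lemma setLIntegral_ofReal_pos {n : ℕ} {f : EuclideanSpace ℝ (Fin n) → ℝ} (hf : Measurable f)
    (hpos : ∀ᵐ x ∂(volume : Measure (EuclideanSpace ℝ (Fin n))), 0 < f x)
    (x : EuclideanSpace ℝ (Fin n)) {r : ℝ} (hr : 0 < r) :
    0 < ∫⁻ y in ball x r, ENNReal.ofReal (f y) := by
  refine pos_iff_ne_zero.2 fun h => ?_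
  rw [lintegral_eq_zero_iff hf.ennreal_ofReal] at h
  have hF : ∀ᵐ y ∂(volume.restrict (ball x r)), False := by
    filter_upwards [h, ae_restrict_of_ae hpos] with y hy hy'
    exact (ENNReal.ofReal_pos.2 hy').ne' hy
  rw [Filter.eventually_false_iff_eq_bot, ae_eq_bot, Measure.restrict_eq_zero] at hF
  exact (measure_ball_pos volume x hr).ne' hF

lemma IsA2.muOmega_ball_lt_top {n : ℕ} {ω : EuclideanSpace ℝ (Fin n) → ℝ} {C : ℝ≥0}
    (hA2 : IsA2 n ω C) (hmeas : Measurable ω)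
    (hpos : ∀ᵐ x ∂(volume : Measure (EuclideanSpace ℝ (Fin n))), 0 < ω x)
    (x : EuclideanSpace ℝ (Fin n)) {r : ℝ} (hr : 0 < r) :
    muOmega n ω (ball x r) < ∞ := by
  rw [muOmega_apply ω measurableSet_ball]
  refine ENNReal.lt_top_of_mul_ne_top_left
    (ne_top_of_le_ne_top ?_ (hA2 x r hr)) (setLIntegral_ofReal_pos hmeas.inv ?_ x hr).ne'
  · exact ENNReal.mul_ne_top ENNReal.coe_ne_top (ENNReal.pow_ne_top measure_ball_lt_top.ne)
  · filter_upwards [hpos] with y hy using inv_pos.2 hy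

lemma IsA2.setLIntegral_inv_lt_top {n : ℕ} {ω : EuclideanSpace ℝ (Fin n) → ℝ} {C : ℝ≥0}
    (hA2 : IsA2 n ω C) (hmeas : Measurable ω)
    (hpos : ∀ᵐ x ∂(volume : Measure (EuclideanSpace ℝ (Fin n))), 0 < ω x)
    (x : EuclideanSpace ℝ (Fin n)) {r : ℝ} (hr : 0 < r) :
    ∫⁻ y in ball x r, ENNReal.ofReal (ω y)⁻¹ < ∞ := by
  refine ENNReal.lt_top_of_mul_ne_top_right
    (ne_top_of_le_ne_top ?_ (hA2 x r hr)) (setLIntegral_ofReal_pos hmeas hpos x hr).ne'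
  exact ENNReal.mul_ne_top ENNReal.coe_ne_top (ENNReal.pow_ne_top measure_ball_lt_top.ne)

lemma IsA2.sq_setLIntegral_mul_muOmega_le {n : ℕ} {ω : EuclideanSpace ℝ (Fin n) → ℝ} {C : ℝ≥0}
    (hA2 : IsA2 n ω C) (hmeas : Measurable ω)
    (hpos : ∀ᵐ x ∂(volume : Measure (EuclideanSpace ℝ (Fin n))), 0 < ω x)
    {g : EuclideanSpace ℝ (Fin n) → ℝ≥0∞} (hg : Measurable g)
    (c : EuclideanSpace ℝ (Fin n)) {r : ℝ} (hr : 0 < r) :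
    (∫⁻ x in ball c r, g x) ^ 2 * muOmega n ω (ball c (6 * r)) ≤
      C * ENNReal.ofReal (6 ^ n) ^ 2 * volume (ball c r) ^ 2 *
        ∫⁻ x in ball c r, g x ^ 2 ∂(muOmega n ω) := by
  have h6 : ball c r ⊆ ball c (6 * r) := ball_subset_ball (by linarith)
  calc (∫⁻ x in ball c r, g x) ^ 2 * muOmega n ω (ball c (6 * r))
      ≤ ((∫⁻ x in ball c r, g x ^ 2 ∂(muOmega n ω)) *
          ∫⁻ x in ball c (6 * r), ENNReal.ofReal (ω x)⁻¹) * muOmega n ω (ball c (6 * r)) := by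
        gcongr
        refine (sq_setLIntegral_le_mul hmeas hpos hg measurableSet_ball).trans ?_
        gcongr
    _ = (∫⁻ x in ball c r, g x ^ 2 ∂(muOmega n ω)) *
          ((∫⁻ x in ball c (6 * r), ENNReal.ofReal (ω x)) *
            ∫⁻ x in ball c (6 * r), ENNReal.ofReal (ω x)⁻¹) := by
        rw [muOmega_apply ω measurableSet_ball]; ring
    _ ≤ (∫⁻ x in ball c r, g x ^ 2 ∂(muOmega n ω)) * (C * volume (ball c (6 * r)) ^ 2) := by
        exact mul_le_mul_right (hA2 c (6 * r) (by linarith)) _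
    _ = _ := by
        rw [volume_ball_mul c c r (by norm_num : (0 : ℝ) < 6)]; ring

/-- Weak type `(2, 2)` estimate for the uncentred maximal function with respect to an `A₂`
weight. -/
lemma IsA2.sq_mul_muOmega_le {n : ℕ} {ω : EuclideanSpace ℝ (Fin n) → ℝ} {C : ℝ≥0}
    (hA2 : IsA2 n ω C) (hmeas : Measurable ω)
    (hpos : ∀ᵐ x ∂(volume : Measure (EuclideanSpace ℝ (Fin n))), 0 < ω x)
    {g : EuclideanSpace ℝ (Fin n) → ℝ≥0∞} (hg : Measurable g)
    {S U : Set (EuclideanSpace ℝ (Fin n))} {ρ : ℝ} {a : ℝ≥0∞}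
    (hS : ∀ x ∈ S, ∃ c r, 0 < r ∧ r ≤ ρ ∧ x ∈ ball c r ∧ ball c r ⊆ U ∧
      a * volume (ball c r) ≤ ∫⁻ y in ball c r, g y) :
    a ^ 2 * muOmega n ω S ≤
      C * ENNReal.ofReal (6 ^ n) ^ 2 * ∫⁻ y in U, g y ^ 2 ∂(muOmega n ω) := by
  choose! c r hr0 hrρ hxc hcU hav using hS
  obtain ⟨v, hvS, hdisj, hcov⟩ :=
    Vitali.exists_disjoint_subfamily_covering_enlargement_closedBall S c r ρ hrρ 5 (by norm_num)
  have hdisj' : v.PairwiseDisjoint fun x => ball (c x) (r x) :=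
    hdisj.mono fun x => ball_subset_closedBall
  have hvc : v.Countable := hdisj'.countable_of_isOpen (fun _ _ => isOpen_ball)
    fun x hx => nonempty_ball.2 (hr0 x (hvS hx))
  have hSsub : S ⊆ ⋃ x ∈ v, ball (c x) (6 * r x) := by
    intro x hx
    obtain ⟨y, hy, hxy⟩ := hcov x hx
    refine Set.mem_biUnion hy (closedBall_subset_ball ?_ (hxy (ball_subset_closedBall (hxc x hx))))
    linarith [hr0 y (hvS hy)]
  have hball : ∀ x ∈ v, a ^ 2 * muOmega n ω (ball (c x) (6 * r x)) ≤
      C * ENNReal.ofReal (6 ^ n) ^ 2 * ∫⁻ y in ball (c x) (r x), g y ^ 2 ∂(muOmega n ω) := by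
    intro x hx
    have hxS := hvS hx
    have hV0 : volume (ball (c x) (r x)) ^ 2 ≠ 0 :=
      pow_ne_zero 2 (measure_ball_pos _ _ (hr0 x hxS)).ne'
    have hV : volume (ball (c x) (r x)) ^ 2 ≠ ∞ := ENNReal.pow_ne_top measure_ball_lt_top.ne
    rw [← ENNReal.mul_le_mul_iff_right hV0 hV]
    calc volume (ball (c x) (r x)) ^ 2 * (a ^ 2 * muOmega n ω (ball (c x) (6 * r x)))
        = (a * volume (ball (c x) (r x))) ^ 2 * muOmega n ω (ball (c x) (6 * r x)) := by ring
      _ ≤ (∫⁻ y in ball (c x) (r x), g y) ^ 2 * muOmega n ω (ball (c x) (6 * r x)) := by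
          gcongr; exact hav x hxS
      _ ≤ _ := hA2.sq_setLIntegral_mul_muOmega_le hmeas hpos hg (c x) (hr0 x hxS)
      _ = _ := by ring
  have : Countable v := hvc.to_subtype
  calc a ^ 2 * muOmega n ω S
      ≤ a ^ 2 * ∑' x : v, muOmega n ω (ball (c x) (6 * r x)) := by
        gcongr
        exact (measure_mono hSsub).trans (measure_biUnion_le _ hvc _)
    _ = ∑' x : v, a ^ 2 * muOmega n ω (ball (c x) (6 * r x)) := ENNReal.tsum_mul_left.symm
    _ ≤ ∑' x : v, C * ENNReal.ofReal (6 ^ n) ^ 2 *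
          ∫⁻ y in ball (c x) (r x), g y ^ 2 ∂(muOmega n ω) :=
        ENNReal.tsum_le_tsum fun x => hball x x.2
    _ = C * ENNReal.ofReal (6 ^ n) ^ 2 *
          ∫⁻ y in ⋃ x ∈ v, ball (c x) (r x), g y ^ 2 ∂(muOmega n ω) := by
        rw [ENNReal.tsum_mul_left,
          lintegral_biUnion hvc (fun _ _ => measurableSet_ball) hdisj']
    _ ≤ _ := by
        gcongr
        exact Set.iUnion₂_subset fun x hx => hcU x (hvS hx)

/-- Weak type Poincaré inequality: the weighted measure of the set where `u` is at distance at least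
`d` from its average over a ball of radius `ε`. -/
lemma IsA2.sq_mul_muOmega_oscillation_le {n : ℕ} {ω : EuclideanSpace ℝ (Fin n) → ℝ} {C : ℝ≥0}
    (hA2 : IsA2 n ω C) (hmeas : Measurable ω)
    (hpos : ∀ᵐ x ∂(volume : Measure (EuclideanSpace ℝ (Fin n))), 0 < ω x)
    {u : EuclideanSpace ℝ (Fin n) → ℝ} (hu : ContDiff ℝ 1 u)
    {S U P : Set (EuclideanSpace ℝ (Fin n))} {ε : ℝ} (hε : 0 < ε) {d : ℝ≥0∞}
    (hP : ∀ p ∈ P, ball p ε ⊆ U)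
    (hS : ∀ x ∈ S, ∃ p ∈ P, x ∈ ball p ε ∧ d ≤ ‖u x - ⨍ y in ball p ε, u y‖ₑ) :
    d ^ 2 * muOmega n ω S ≤ C * ENNReal.ofReal (6 ^ n) ^ 2 * ENNReal.ofReal (2 * ε) ^ 2 *
      ∫⁻ y in U, ‖fderiv ℝ u y‖ₑ ^ 2 ∂(muOmega n ω) := by
  have hfd : Continuous (fderiv ℝ u) := hu.continuous_fderiv one_ne_zero
  have he0 : ENNReal.ofReal (2 * ε) ≠ 0 := by simpa using hε
  have he : ENNReal.ofReal (2 * ε) ≠ ∞ := ENNReal.ofReal_ne_top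
  have h := hA2.sq_mul_muOmega_le hmeas hpos hfd.enorm.measurable (S := S) (U := U) (ρ := ε)
    (a := d / ENNReal.ofReal (2 * ε)) ?_
  · calc d ^ 2 * muOmega n ω S
        = ENNReal.ofReal (2 * ε) ^ 2 *
            ((d / ENNReal.ofReal (2 * ε)) ^ 2 * muOmega n ω S) := by
          rw [← mul_assoc, ← mul_pow, ENNReal.mul_div_cancel he0 he]
      _ ≤ _ := mul_le_mul_right h _
      _ = _ := by ring
  · intro x hx
    obtain ⟨p, hp, hxp, hd⟩ := hS x hx
    obtain ⟨t, ht, h⟩ := exists_enorm_sub_setAverage_le hu hε hxp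
    refine ⟨x + t • (p - x), t * ε, mul_pos ht.1 hε, ?_, ?_, ?_, ?_⟩
    · nlinarith [ht.2]
    · rw [mem_ball, dist_comm, dist_eq_norm, add_sub_cancel_left, norm_smul, Real.norm_eq_abs,
        abs_of_pos ht.1, ← dist_eq_norm, dist_comm]
      exact mul_lt_mul_of_pos_left hxp ht.1
    · refine (ball_subset_ball' ?_).trans (hP p hp)
      have h1 : x + t • (p - x) - p = (1 - t) • (x - p) := by module
      rw [dist_eq_norm, h1, norm_smul, Real.norm_eq_abs, abs_of_nonneg (by linarith [ht.2]),
        ← dist_eq_norm]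
      nlinarith [mul_le_mul_of_nonneg_left (mem_ball.1 hxp).le (sub_nonneg.2 ht.2)]
    · rw [ENNReal.div_eq_inv_mul, mul_assoc, mul_comm, ← ENNReal.div_eq_inv_mul.trans (mul_comm _ _)]
      refine ENNReal.div_le_of_le_mul' (le_trans ?_ h)
      gcongr

lemma exists_contDiff_cutoff : ∃ (η : ℝ → ℝ) (L : ℝ≥0), ContDiff ℝ 1 η ∧
    (∀ t, |t| ≤ 1 → η t = 0) ∧ (∀ t, 2 ≤ |t| → η t = 1) ∧ (∀ t, |η t| ≤ 1) ∧
    (∀ t, ‖deriv η t‖ₑ ≤ L) ∧ (∀ t, |t| ≤ 1 → deriv η t = 0) ∧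
    (∀ t, 2 ≤ |t| → deriv η t = 0) := by
  set η : ℝ → ℝ := fun t => Real.smoothTransition (t ^ 2 - 1) with hη
  have hC : ContDiff ℝ 1 η :=
    (Real.smoothTransition.contDiff (n := 1)).comp (by fun_prop : ContDiff ℝ 1 fun t : ℝ => t ^ 2 - 1)
  have h0 : ∀ t, |t| ≤ 1 → η t = 0 := fun t ht =>
    Real.smoothTransition.zero_of_nonpos (by nlinarith [sq_abs t, abs_nonneg t])
  have h1 : ∀ t, 2 ≤ |t| → η t = 1 := fun t ht =>
    Real.smoothTransition.one_of_one_le (by nlinarith [sq_abs t, abs_nonneg t])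
  have hd0 : ∀ t, |t| ≤ 1 → deriv η t = 0 := fun t ht =>
    IsLocalMin.deriv_eq_zero (Filter.Eventually.of_forall fun s => by
      rw [h0 t ht]; exact Real.smoothTransition.nonneg _)
  have hd1 : ∀ t, 2 ≤ |t| → deriv η t = 0 := fun t ht =>
    IsLocalMax.deriv_eq_zero (Filter.Eventually.of_forall fun s => by
      rw [h1 t ht]; exact Real.smoothTransition.le_one _)
  obtain ⟨L, hL⟩ := (isCompact_Icc (a := (-2 : ℝ)) (b := 2)).exists_bound_of_continuousOn
    (hC.continuous_deriv le_rfl).continuousOn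
  refine ⟨η, L.toNNReal, hC, h0, h1, fun t => ?_, fun t => ?_, hd0, hd1⟩
  · rw [abs_of_nonneg (Real.smoothTransition.nonneg _)]
    exact Real.smoothTransition.le_one _
  · rw [← ofReal_norm]
    refine ENNReal.ofReal_le_ofReal ?_
    by_cases ht : 2 ≤ |t|
    · rw [hd1 t ht, norm_zero]
      exact (norm_nonneg _).trans (hL 0 (by norm_num))
    · exact hL t (Set.mem_Icc.2 (abs_le.1 (not_le.1 ht).le))

lemma enorm_setAverage_mul_le {n : ℕ} (u : EuclideanSpace ℝ (Fin n) → ℝ)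
    (p : EuclideanSpace ℝ (Fin n)) {ε : ℝ} (hε : 0 < ε) :
    ‖⨍ y in ball p ε, u y‖ₑ * volume (ball p ε) ≤ ∫⁻ y in ball p ε, ‖u y‖ₑ := by
  have hV : volume (ball p ε) ≠ ∞ := measure_ball_lt_top.ne
  have h0 : volume.real (ball p ε) ≠ 0 :=
    (ENNReal.toReal_pos (measure_ball_pos _ _ hε).ne' hV).ne'
  have h1 : (⨍ y in ball p ε, u y) * volume.real (ball p ε) = ∫ y in ball p ε, u y := by
    rw [setAverage_eq, smul_eq_mul]
    field_simp
  rw [← ofReal_measureReal hV, ← Real.enorm_of_nonneg measureReal_nonneg, ← enorm_mul, h1]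
  exact enorm_integral_le_lintegral_enorm _

/-- Estimate at a single level for the truncation argument. -/
lemma IsA2.sq_mul_muOmega_level_le {n : ℕ} {ω : EuclideanSpace ℝ (Fin n) → ℝ} {C : ℝ≥0}
    (hA2 : IsA2 n ω C) (hmeas : Measurable ω)
    (hpos : ∀ᵐ x ∂(volume : Measure (EuclideanSpace ℝ (Fin n))), 0 < ω x) :
    ∃ L : ℝ≥0, ∀ (w : EuclideanSpace ℝ (Fin n) → ℝ), ContDiff ℝ 1 w →
      ∀ (S U P : Set (EuclideanSpace ℝ (Fin n))) (ε : ℝ), 0 < ε → MeasurableSet U →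
      (∀ p ∈ P, ball p ε ⊆ U) → S ⊆ ⋃ p ∈ P, ball p ε → ∀ c : ℝ, 0 < c →
      (∀ p ∈ P, ∫⁻ y in ball p ε, ‖w y‖ₑ ≤ ENNReal.ofReal (c / 2) * volume (ball p ε)) →
      ENNReal.ofReal (c / 2) ^ 2 * muOmega n ω (S ∩ {x | 2 * c ≤ |w x|}) ≤
        L * ENNReal.ofReal (2 * ε) ^ 2 *
          ∫⁻ y in U ∩ {x | c < |w x| ∧ |w x| < 2 * c}, ‖fderiv ℝ w y‖ₑ ^ 2 ∂(muOmega n ω) := by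
  obtain ⟨η, L, hηC, hη0, hη1, hηb, hηL, hηd0, hηd1⟩ := exists_contDiff_cutoff
  refine ⟨C * (6 ^ n) ^ 2 * L ^ 2, fun w hw S U P ε hε hU hP hSP c hc hM => ?_⟩
  set v : EuclideanSpace ℝ (Fin n) → ℝ := fun x => c * η (w x / c) with hv
  have hvC : ContDiff ℝ 1 v := contDiff_const.mul (hηC.comp (hw.div_const c))
  have habs : ∀ x, |w x / c| = |w x| / c := fun x => by rw [abs_div, abs_of_pos hc]
  have hvle : ∀ x, ‖v x‖ₑ ≤ ‖w x‖ₑ := by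
    intro x
    rw [← ofReal_norm, ← ofReal_norm]
    refine ENNReal.ofReal_le_ofReal ?_
    rw [Real.norm_eq_abs, Real.norm_eq_abs, hv]
    by_cases h : |w x / c| ≤ 1
    · simp only [hη0 _ h, mul_zero, abs_zero]; positivity
    · rw [habs, not_le, lt_div_iff₀ hc, one_mul] at h
      simp only [abs_mul, abs_of_pos hc]
      nlinarith [hηb (w x / c)]
  have hfd : ∀ x, fderiv ℝ v x = deriv η (w x / c) • fderiv ℝ w x := by
    intro x
    have h1 : HasFDerivAt (fun x => w x / c) (c⁻¹ • fderiv ℝ w x) x := by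
      simpa [div_eq_mul_inv] using
        ((hw.differentiable one_ne_zero) x).hasFDerivAt.mul_const c⁻¹
    have h2 := ((hηC.differentiable one_ne_zero) (w x / c)).hasDerivAt.comp_hasFDerivAt x h1
    have h3 : HasFDerivAt v (c • (deriv η (w x / c) • c⁻¹ • fderiv ℝ w x)) x := h2.const_mul c
    rw [h3.fderiv, smul_comm, smul_smul c, mul_inv_cancel₀ hc.ne', one_smul]
  have hB : MeasurableSet {x | c < |w x| ∧ |w x| < 2 * c} := by
    have := hw.continuous
    exact (isOpen_lt continuous_const this.abs).inter (isOpen_lt this.abs continuous_const)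
      |>.measurableSet
  have hgrad : ∫⁻ y in U, ‖fderiv ℝ v y‖ₑ ^ 2 ∂(muOmega n ω) ≤ L ^ 2 *
      ∫⁻ y in U ∩ {x | c < |w x| ∧ |w x| < 2 * c}, ‖fderiv ℝ w y‖ₑ ^ 2 ∂(muOmega n ω) := by
    rw [← lintegral_const_mul' _ _ (by simp), Set.inter_comm, ← setLIntegral_indicator hB]
    refine lintegral_mono fun x => ?_
    rw [hfd, enorm_smul]
    by_cases h : x ∈ {x | c < |w x| ∧ |w x| < 2 * c}
    · rw [Set.indicator_of_mem h, mul_pow]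
      gcongr
      exact hηL _
    · have h0 : deriv η (w x / c) = 0 := by
        rw [Set.mem_ofPred_eq, not_and_or, not_lt, not_lt] at h
        rcases h with h | h
        · exact hηd0 _ (by rw [habs, div_le_one hc]; exact h)
        · exact hηd1 _ (by rw [habs, le_div_iff₀ hc]; exact h)
      rw [h0]; simp
  have key := hA2.sq_mul_muOmega_oscillation_le hmeas hpos hvC hε (d := ENNReal.ofReal (c / 2))
    (S := S ∩ {x | 2 * c ≤ |w x|}) hP ?_
  · refine key.trans ((mul_le_mul_right hgrad _).trans_eq ?_)
    rw [ENNReal.ofReal_pow (by norm_num)]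
    push_cast
    rw [ENNReal.ofReal_ofNat]
    ring
  · rintro x ⟨hxS, hx⟩
    obtain ⟨p, hp, hxp⟩ := Set.mem_iUnion₂.1 (hSP hxS)
    refine ⟨p, hp, hxp, ?_⟩
    have hvx : v x = c := by
      simp only [hv]
      rw [hη1 _ (by rw [habs, le_div_iff₀ hc]; exact hx), mul_one]
    have havg : ‖⨍ y in ball p ε, v y‖ₑ ≤ ENNReal.ofReal (c / 2) := by
      have hV0 : volume (ball p ε) ≠ 0 := (measure_ball_pos _ _ hε).ne'
      have hV : volume (ball p ε) ≠ ∞ := measure_ball_lt_top.ne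
      rw [← ENNReal.mul_le_mul_iff_left hV0 hV]
      exact (enorm_setAverage_mul_le v p hε).trans ((lintegral_mono hvle).trans (hM p hp))
    rw [hvx]
    rw [← ofReal_norm, ENNReal.ofReal_le_ofReal_iff (by positivity), Real.norm_eq_abs] at havg
    rw [← ofReal_norm]
    refine ENNReal.ofReal_le_ofReal ((le_abs_self _).trans' ?_)
    linarith [le_abs_self (⨍ y in ball p ε, v y)]

/-- Tail estimate, obtained by summing the level estimates over dyadic levels. -/
lemma IsA2.lintegral_tail_le {n : ℕ} {ω : EuclideanSpace ℝ (Fin n) → ℝ} {C : ℝ≥0}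
    (hA2 : IsA2 n ω C) (hmeas : Measurable ω)
    (hpos : ∀ᵐ x ∂(volume : Measure (EuclideanSpace ℝ (Fin n))), 0 < ω x) :
    ∃ L : ℝ≥0, ∀ (w : EuclideanSpace ℝ (Fin n) → ℝ), ContDiff ℝ 1 w →
      ∀ (S U P : Set (EuclideanSpace ℝ (Fin n))) (ε : ℝ), 0 < ε → MeasurableSet U →
      MeasurableSet S →
      (∀ p ∈ P, ball p ε ⊆ U) → S ⊆ ⋃ p ∈ P, ball p ε → ∀ c : ℝ, 0 < c →
      (∀ p ∈ P, ∫⁻ y in ball p ε, ‖w y‖ₑ ≤ ENNReal.ofReal (c / 2) * volume (ball p ε)) →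
      ∫⁻ y in S ∩ {x | 2 * c ≤ |w x|}, ‖w y‖ₑ ^ 2 ∂(muOmega n ω) ≤
        L * ENNReal.ofReal (2 * ε) ^ 2 *
          ∫⁻ y in U, ‖fderiv ℝ w y‖ₑ ^ 2 ∂(muOmega n ω) := by
  obtain ⟨L, hL⟩ := hA2.sq_mul_muOmega_level_le hmeas hpos
  refine ⟨64 * L, fun w hw S U P ε hε hU hS hP hSP c hc hM => ?_⟩
  have hwc := hw.continuous
  have hcpos : ∀ k : ℕ, 0 < 2 ^ k * c := fun k => by positivity
  set T : ℕ → Set (EuclideanSpace ℝ (Fin n)) := fun k =>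
    S ∩ {x | 2 * (2 ^ k * c) ≤ |w x| ∧ |w x| < 4 * (2 ^ k * c)} with hT
  set G : ℕ → Set (EuclideanSpace ℝ (Fin n)) := fun k =>
    U ∩ {x | 2 ^ k * c < |w x| ∧ |w x| < 2 * (2 ^ k * c)} with hG
  have hTm : ∀ k, MeasurableSet (T k) := fun k => hS.inter
    ((isClosed_le continuous_const hwc.abs).measurableSet.inter
      (isOpen_lt hwc.abs continuous_const).measurableSet)
  have hGm : ∀ k, MeasurableSet (G k) := fun k => hU.inter
    ((isOpen_lt continuous_const hwc.abs).measurableSet.inter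
      (isOpen_lt hwc.abs continuous_const).measurableSet)
  have hGd : Pairwise (Function.onFun Disjoint G) := by
    rw [pairwise_disjoint_on]
    intro i j hij
    refine Set.disjoint_left.2 fun x hxi hxj => ?_
    have h1 : |w x| < 2 * (2 ^ i * c) := hxi.2.2
    have h2 : 2 ^ j * c < |w x| := hxj.2.1
    have h3 : (2 : ℝ) ^ (i + 1) ≤ 2 ^ j := pow_le_pow_right₀ one_le_two hij
    rw [pow_succ] at h3
    nlinarith
  have hcover : S ∩ {x | 2 * c ≤ |w x|} ⊆ ⋃ k, T k := by
    rintro x ⟨hxS, hx⟩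
    have hx' : 1 ≤ |w x| / (2 * c) := (one_le_div (by positivity)).2 hx
    obtain ⟨k, hk1, hk2⟩ := exists_nat_pow_near hx' one_lt_two
    rw [le_div_iff₀ (by positivity)] at hk1
    rw [div_lt_iff₀ (by positivity), pow_succ] at hk2
    refine Set.mem_iUnion.2 ⟨k, hxS, ?_, ?_⟩ <;> linarith
  have hlevel : ∀ k, ∫⁻ y in T k, ‖w y‖ₑ ^ 2 ∂(muOmega n ω) ≤
      ↑(64 * L) * ENNReal.ofReal (2 * ε) ^ 2 *
        ∫⁻ y in G k, ‖fderiv ℝ w y‖ₑ ^ 2 ∂(muOmega n ω) := by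
    intro k
    have h := hL w hw S U P ε hε hU hP hSP (2 ^ k * c) (hcpos k) fun p hp => (hM p hp).trans ?_
    · calc ∫⁻ y in T k, ‖w y‖ₑ ^ 2 ∂(muOmega n ω)
          ≤ ∫⁻ y in T k, 64 * ENNReal.ofReal (2 ^ k * c / 2) ^ 2 ∂(muOmega n ω) := by
            refine setLIntegral_mono' (hTm k) fun x hx => ?_
            have : (64 : ℝ≥0∞) = ENNReal.ofReal 8 ^ 2 := by
              rw [ENNReal.ofReal_ofNat]; norm_num
            rw [this, ← mul_pow, ← ENNReal.ofReal_mul (by norm_num), ← ofReal_norm]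
            gcongr
            rw [Real.norm_eq_abs]
            linarith [hx.2.2]
        _ = 64 * (ENNReal.ofReal (2 ^ k * c / 2) ^ 2 * muOmega n ω (T k)) := by
            rw [setLIntegral_const, mul_assoc]
        _ ≤ 64 * (ENNReal.ofReal (2 ^ k * c / 2) ^ 2 *
              muOmega n ω (S ∩ {x | 2 * (2 ^ k * c) ≤ |w x|})) := by
            gcongr
            exact fun x hx => ⟨hx.1, hx.2.1⟩
        _ ≤ _ := mul_le_mul_right h _
        _ = _ := by push_cast; ring
    · gcongr
      exact le_mul_of_one_le_left hc.le (one_le_pow₀ one_le_two)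
  calc ∫⁻ y in S ∩ {x | 2 * c ≤ |w x|}, ‖w y‖ₑ ^ 2 ∂(muOmega n ω)
      ≤ ∫⁻ y in ⋃ k, T k, ‖w y‖ₑ ^ 2 ∂(muOmega n ω) := lintegral_mono_set hcover
    _ ≤ ∑' k, ∫⁻ y in T k, ‖w y‖ₑ ^ 2 ∂(muOmega n ω) := lintegral_iUnion_le _ _
    _ ≤ ∑' k, ↑(64 * L) * ENNReal.ofReal (2 * ε) ^ 2 *
          ∫⁻ y in G k, ‖fderiv ℝ w y‖ₑ ^ 2 ∂(muOmega n ω) := ENNReal.tsum_le_tsum hlevel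
    _ = ↑(64 * L) * ENNReal.ofReal (2 * ε) ^ 2 *
          ∫⁻ y in ⋃ k, G k, ‖fderiv ℝ w y‖ₑ ^ 2 ∂(muOmega n ω) := by
        rw [ENNReal.tsum_mul_left, lintegral_iUnion hGm hGd]
    _ ≤ _ := by
        gcongr
        exact Set.iUnion_subset fun k => Set.inter_subset_left

lemma exists_mul_ofReal_sq_le {B : ℝ≥0∞} (hB : B ≠ ∞) {δ : ℝ≥0∞} (hδ : 0 < δ) {ρ : ℝ}
    (hρ : 0 < ρ) : ∃ ε, 0 < ε ∧ ε ≤ ρ ∧ B * ENNReal.ofReal (2 * ε) ^ 2 ≤ δ := by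
  have h : Filter.Tendsto (fun ε : ℝ => B * ENNReal.ofReal (2 * ε) ^ 2)
      (nhdsWithin 0 (Set.Ioi 0)) (nhds 0) := by
    have h1 : Continuous fun ε : ℝ => ENNReal.ofReal (2 * ε) ^ 2 :=
      (ENNReal.continuous_pow 2).comp (ENNReal.continuous_ofReal.comp (by fun_prop))
    have h2 := ENNReal.Tendsto.const_mul (h1.tendsto 0) (Or.inr hB)
    simp only [mul_zero, ENNReal.ofReal_zero, ne_eq, OfNat.ofNat_ne_zero, not_false_eq_true,
      zero_pow] at h2
    exact h2.mono_left nhdsWithin_le_nhds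
  obtain ⟨ε, h1, h2⟩ := ((h.eventually (ge_mem_nhds hδ)).and
    (Ioc_mem_nhdsGT hρ)).exists
  exact ⟨ε, h2.1, h2.2, h1⟩

lemma exists_finite_cover_ball {n : ℕ} (x₀ : EuclideanSpace ℝ (Fin n)) {R R' ε : ℝ} (hε : 0 < ε)
    (h : ε ≤ R - R') : ∃ P : Set (EuclideanSpace ℝ (Fin n)), P.Finite ∧
      (∀ p ∈ P, ball p ε ⊆ ball x₀ R) ∧ ball x₀ R' ⊆ ⋃ p ∈ P, ball p ε := by
  obtain ⟨P, hP, hfin, hcov⟩ := finite_cover_balls_of_compact (isCompact_closedBall x₀ R') hε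
  refine ⟨P, hfin, fun p hp => ball_subset_ball' ?_, ball_subset_closedBall.trans hcov⟩
  linarith [mem_closedBall.1 (hP hp)]

lemma IsA2.setLIntegral_enorm_le {n : ℕ} {ω : EuclideanSpace ℝ (Fin n) → ℝ} {C : ℝ≥0}
    (hA2 : IsA2 n ω C) (hmeas : Measurable ω)
    (hpos : ∀ᵐ x ∂(volume : Measure (EuclideanSpace ℝ (Fin n))), 0 < ω x)
    (x₀ : EuclideanSpace ℝ (Fin n)) {R : ℝ} (hR : 0 < R) (K : ℝ≥0) :
    ∃ M : ℝ≥0, ∀ w : EuclideanSpace ℝ (Fin n) → ℝ, Measurable w →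
      ∫⁻ y in ball x₀ R, ‖w y‖ₑ ^ 2 ∂(muOmega n ω) ≤ K → ∫⁻ y in ball x₀ R, ‖w y‖ₑ ≤ M := by
  lift ∫⁻ y in ball x₀ R, ENNReal.ofReal (ω y)⁻¹ to ℝ≥0
    using (hA2.setLIntegral_inv_lt_top hmeas hpos x₀ hR).ne with I hI
  refine ⟨K * I + 1, fun w hw h => ?_⟩
  have h1 := sq_setLIntegral_le_mul hmeas hpos hw.enorm (measurableSet_ball (x := x₀) (ε := R))
  rw [← hI] at h1
  have h2 : (∫⁻ y in ball x₀ R, ‖w y‖ₑ) ^ 2 ≤ K * I := h1.trans (by gcongr)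
  push_cast
  rcases le_total (∫⁻ y in ball x₀ R, ‖w y‖ₑ) 1 with h3 | h3
  · exact h3.trans le_add_self
  · exact ((le_self_pow₀ h3 two_ne_zero).trans h2).trans le_self_add

/-- An Ehrling type inequality: the weighted `L²` norm of a function with bounded energy is small as
soon as finitely many of its averages are small. -/
lemma IsA2.exists_finite_averages {n : ℕ} {ω : EuclideanSpace ℝ (Fin n) → ℝ} {C : ℝ≥0}
    (hA2 : IsA2 n ω C) (hmeas : Measurable ω)
    (hpos : ∀ᵐ x ∂(volume : Measure (EuclideanSpace ℝ (Fin n))), 0 < ω x)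
    (x₀ : EuclideanSpace ℝ (Fin n)) {R R' : ℝ} (hR' : 0 < R') (hRR : R' < R) (K : ℝ≥0)
    {δ : ℝ≥0∞} (hδ : 0 < δ) :
    ∃ (ε : ℝ) (P : Set (EuclideanSpace ℝ (Fin n))) (s : ℝ), 0 < ε ∧ P.Finite ∧ 0 < s ∧
      (∀ p ∈ P, ball p ε ⊆ ball x₀ R) ∧
      ∀ w : EuclideanSpace ℝ (Fin n) → ℝ, ContDiff ℝ 1 w →
        ∫⁻ y in ball x₀ R, ‖w y‖ₑ ^ 2 ∂(muOmega n ω) ≤ K →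
        ∫⁻ y in ball x₀ R, ‖fderiv ℝ w y‖ₑ ^ 2 ∂(muOmega n ω) ≤ K →
        (∀ p ∈ P, |⨍ y in ball p ε, w y| ≤ s) →
        ∫⁻ y in ball x₀ R', ‖w y‖ₑ ^ 2 ∂(muOmega n ω) ≤ δ := by
  obtain ⟨L, hL⟩ := hA2.lintegral_tail_le hmeas hpos
  obtain ⟨M, hM⟩ := hA2.setLIntegral_enorm_le hmeas hpos x₀ (hR'.trans hRR) K
  have hδ3 : 0 < δ / 3 := ENNReal.div_pos hδ.ne' (by simp)
  have hρ : 0 < R - R' := sub_pos.2 hRR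
  obtain ⟨ε₁, hε₁, hε₁ρ, hε₁δ⟩ := exists_mul_ofReal_sq_le (B := L * K)
    (ENNReal.mul_ne_top (by simp) (by simp)) hδ3 hρ
  obtain ⟨P₁, -, hP₁, hcov₁⟩ := exists_finite_cover_ball x₀ hε₁ hε₁ρ
  set V := volume (ball (0 : EuclideanSpace ℝ (Fin n)) ε₁) with hVdef
  have hV0 : V ≠ 0 := (measure_ball_pos _ _ hε₁).ne'
  have hV : V ≠ ∞ := measure_ball_lt_top.ne
  set c : ℝ := 2 * ((M : ℝ≥0∞) / V).toReal + 1 with hc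
  have hc0 : 0 < c := by positivity
  have hcM : (M : ℝ≥0∞) ≤ ENNReal.ofReal (c / 2) * V := by
    have hq : (M : ℝ≥0∞) / V ≠ ∞ := ENNReal.div_ne_top (by simp) hV0
    rw [← ENNReal.div_le_iff hV0 hV, ← ENNReal.ofReal_toReal hq]
    refine ENNReal.ofReal_le_ofReal ?_
    rw [hc]; linarith
  obtain ⟨s, hs, -, hsδ⟩ := exists_mul_ofReal_sq_le (B := muOmega n ω (ball x₀ R'))
    (hA2.muOmega_ball_lt_top hmeas hpos x₀ hR').ne hδ3 one_pos
  have hs0 : ENNReal.ofReal s ^ 2 ≠ 0 := pow_ne_zero 2 (by simpa using hs)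
  have hst : ENNReal.ofReal s ^ 2 ≠ ∞ := ENNReal.pow_ne_top ENNReal.ofReal_ne_top
  obtain ⟨ε, hε, hερ, hεδ⟩ := exists_mul_ofReal_sq_le
    (B := ENNReal.ofReal (2 * c) ^ 2 * ((C * ENNReal.ofReal (6 ^ n) ^ 2 * K) /
      ENNReal.ofReal s ^ 2)) (by
        refine ENNReal.mul_ne_top (ENNReal.pow_ne_top ENNReal.ofReal_ne_top)
          (ENNReal.div_ne_top (ENNReal.mul_ne_top (ENNReal.mul_ne_top (by simp)
            (ENNReal.pow_ne_top ENNReal.ofReal_ne_top)) (by simp)) hs0)) hδ3 hρ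
  obtain ⟨P, hfin, hP, hcov⟩ := exists_finite_cover_ball x₀ hε hερ
  refine ⟨ε, P, s, hε, hfin, hs, hP, fun w hw hwK hgK havg => ?_⟩
  have hwc := hw.continuous
  set A₁ := ball x₀ R' ∩ {x | 2 * c ≤ |w x|} with hA₁
  set A₂ := ball x₀ R' ∩ {x | 2 * s ≤ |w x| ∧ |w x| < 2 * c} with hA₂
  set A₃ := ball x₀ R' ∩ {x | |w x| < 2 * s} with hA₃
  have hm₂ : MeasurableSet A₂ := measurableSet_ball.inter
    ((isClosed_le continuous_const hwc.abs).measurableSet.inter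
      (isOpen_lt hwc.abs continuous_const).measurableSet)
  have hm₃ : MeasurableSet A₃ := measurableSet_ball.inter
      (isOpen_lt hwc.abs continuous_const).measurableSet
  have hsub : ball x₀ R' ⊆ A₁ ∪ (A₂ ∪ A₃) := by
    intro x hx
    rcases lt_or_ge (|w x|) (2 * s) with h | h
    · exact Or.inr (Or.inr ⟨hx, h⟩)
    · rcases lt_or_ge (|w x|) (2 * c) with h' | h'
      · exact Or.inr (Or.inl ⟨hx, h, h'⟩)
      · exact Or.inl ⟨hx, h'⟩
  have h₁ : ∫⁻ y in A₁, ‖w y‖ₑ ^ 2 ∂(muOmega n ω) ≤ δ / 3 := by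
    refine (hL w hw (ball x₀ R') (ball x₀ R) P₁ ε₁ hε₁ measurableSet_ball measurableSet_ball hP₁
      hcov₁ c hc0 fun p hp => ?_).trans ?_
    · rw [Measure.addHaar_ball_center, ← hVdef]
      exact ((lintegral_mono_set (hP₁ p hp)).trans (hM w hwc.measurable hwK)).trans hcM
    · refine (mul_le_mul_right hgK _).trans (le_of_eq_of_le ?_ hε₁δ)
      ring
  have hbd : ∀ {x : EuclideanSpace ℝ (Fin n)} {b : ℝ}, |w x| < b →
      ‖w x‖ₑ ^ 2 ≤ ENNReal.ofReal b ^ 2 := by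
    intro x b h
    rw [← ofReal_norm]
    gcongr
    exact h.le
  have h₃ : ∫⁻ y in A₃, ‖w y‖ₑ ^ 2 ∂(muOmega n ω) ≤ δ / 3 := by
    calc ∫⁻ y in A₃, ‖w y‖ₑ ^ 2 ∂(muOmega n ω)
        ≤ ∫⁻ y in A₃, ENNReal.ofReal (2 * s) ^ 2 ∂(muOmega n ω) :=
          setLIntegral_mono' hm₃ fun x hx => hbd hx.2
      _ = muOmega n ω A₃ * ENNReal.ofReal (2 * s) ^ 2 := by rw [setLIntegral_const, mul_comm]
      _ ≤ muOmega n ω (ball x₀ R') * ENNReal.ofReal (2 * s) ^ 2 :=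
          mul_le_mul_left (measure_mono Set.inter_subset_left) _
      _ ≤ δ / 3 := hsδ
  have h₂ : ∫⁻ y in A₂, ‖w y‖ₑ ^ 2 ∂(muOmega n ω) ≤ δ / 3 := by
    have hosc := hA2.sq_mul_muOmega_oscillation_le hmeas hpos hw hε (d := ENNReal.ofReal s)
      (S := A₂) hP ?_
    · have hμ : muOmega n ω A₂ ≤ (C * ENNReal.ofReal (6 ^ n) ^ 2 * K) /
          ENNReal.ofReal s ^ 2 * ENNReal.ofReal (2 * ε) ^ 2 := by
        rw [← ENNReal.mul_div_right_comm, ENNReal.le_div_iff_mul_le (Or.inl hs0) (Or.inl hst),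
          mul_comm]
        refine hosc.trans ((mul_le_mul_right hgK _).trans_eq ?_)
        ring
      calc ∫⁻ y in A₂, ‖w y‖ₑ ^ 2 ∂(muOmega n ω)
          ≤ ∫⁻ y in A₂, ENNReal.ofReal (2 * c) ^ 2 ∂(muOmega n ω) :=
            setLIntegral_mono' hm₂ fun x hx => hbd hx.2.2
        _ = ENNReal.ofReal (2 * c) ^ 2 * muOmega n ω A₂ := setLIntegral_const _ _
        _ ≤ _ := mul_le_mul_right hμ _
        _ ≤ δ / 3 := by rw [← mul_assoc]; exact hεδ
    · rintro x ⟨hxB, hx, -⟩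
      obtain ⟨p, hp, hxp⟩ := Set.mem_iUnion₂.1 (hcov hxB)
      refine ⟨p, hp, hxp, ?_⟩
      rw [← ofReal_norm]
      refine ENNReal.ofReal_le_ofReal ?_
      have := abs_sub_abs_le_abs_sub (w x) (⨍ y in ball p ε, w y)
      rw [Real.norm_eq_abs]
      linarith [havg p hp]
  calc ∫⁻ y in ball x₀ R', ‖w y‖ₑ ^ 2 ∂(muOmega n ω)
      ≤ ∫⁻ y in A₁ ∪ (A₂ ∪ A₃), ‖w y‖ₑ ^ 2 ∂(muOmega n ω) := lintegral_mono_set hsub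
    _ ≤ ∫⁻ y in A₁, ‖w y‖ₑ ^ 2 ∂(muOmega n ω) + (∫⁻ y in A₂, ‖w y‖ₑ ^ 2 ∂(muOmega n ω) +
          ∫⁻ y in A₃, ‖w y‖ₑ ^ 2 ∂(muOmega n ω)) :=
        (lintegral_union_le _ _ _).trans (add_le_add_right (lintegral_union_le _ _ _) _)
    _ ≤ δ / 3 + (δ / 3 + δ / 3) := add_le_add h₁ (add_le_add h₂ h₃)
    _ = δ := by rw [← add_assoc, ENNReal.add_thirds]

lemma lintegral_enorm_sub_sq_le {α F : Type*} [MeasurableSpace α] [NormedAddCommGroup F]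
    (μ : Measure α) {f g : α → F} (hf : AEMeasurable (fun x => ‖f x‖ₑ) μ) :
    ∫⁻ x, ‖f x - g x‖ₑ ^ 2 ∂μ ≤ 2 * (∫⁻ x, ‖f x‖ₑ ^ 2 ∂μ + ∫⁻ x, ‖g x‖ₑ ^ 2 ∂μ) := by
  rw [← lintegral_add_left' (hf.pow_const 2), ← lintegral_const_mul' _ _ (by simp)]
  refine lintegral_mono fun x => ?_
  calc ‖f x - g x‖ₑ ^ 2 ≤ (‖f x‖ₑ + ‖g x‖ₑ) ^ 2 := by gcongr; exact enorm_sub_le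
    _ ≤ _ := by
      simpa [show (2 : ℝ) - 1 = 1 by norm_num] using
        ENNReal.rpow_add_le_mul_rpow_add_rpow ‖f x‖ₑ ‖g x‖ₑ one_le_two

lemma exists_subseq_tendsto_of_bounded {ι : Type*} [Countable ι] (a : ℕ → ι → ℝ) (b : ι → ℝ)
    (h : ∀ j i, |a j i| ≤ b i) :
    ∃ (φ : ℕ → ℕ) (l : ι → ℝ), StrictMono φ ∧
      ∀ i, Filter.Tendsto (fun k => a (φ k) i) Filter.atTop (nhds (l i)) := by
  have hc : IsCompact (Set.univ.pi fun i => Set.Icc (-b i) (b i)) :=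
    isCompact_univ_pi fun i => isCompact_Icc
  obtain ⟨l, -, φ, hφ, hl⟩ := hc.tendsto_subseq (x := a) fun j i _ => abs_le.1 (h j i)
  exact ⟨φ, l, hφ, tendsto_pi_nhds.1 hl⟩

lemma eLpNorm_two_sq {α F : Type*} [MeasurableSpace α] [NormedAddCommGroup F]
    (μ : Measure α) (f : α → F) : eLpNorm f 2 μ ^ 2 = ∫⁻ x, ‖f x‖ₑ ^ 2 ∂μ := by
  have h := eLpNorm_nnreal_pow_eq_lintegral (f := f) (μ := μ) (p := 2) two_ne_zero
  simpa using h

/-- Completeness of `L²` in terms of integrals of squares. -/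
lemma exists_tendsto_lintegral_sq {α : Type*} [MeasurableSpace α] (μ : Measure α)
    {f : ℕ → α → ℝ} (hf : ∀ k, MemLp (f k) 2 μ)
    (hcau : ∀ δ : ℝ≥0∞, 0 < δ → ∃ N, ∀ k ≥ N, ∀ l ≥ N,
      ∫⁻ x, ‖f k x - f l x‖ₑ ^ 2 ∂μ ≤ δ) :
    ∃ v : α → ℝ, Measurable v ∧
      Filter.Tendsto (fun k => ∫⁻ x, ‖f k x - v x‖ₑ ^ 2 ∂μ) Filter.atTop (nhds 0) := by
  have hC : CauchySeq fun k => (hf k).toLp (f k) := by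
    rw [EMetric.cauchySeq_iff]
    intro e he
    obtain ⟨r, hr0, hre⟩ := exists_between he
    obtain ⟨N, hN⟩ := hcau (r ^ 2) (ENNReal.pow_pos hr0 2)
    refine ⟨N, fun k hk l hl => lt_of_le_of_lt ?_ hre⟩
    rw [Lp.edist_toLp_toLp, ← ENNReal.pow_le_pow_left_iff two_ne_zero, eLpNorm_two_sq]
    exact hN k hk l hl
  obtain ⟨v, hv⟩ := cauchySeq_tendsto_of_complete hC
  refine ⟨v, (Lp.stronglyMeasurable v).measurable, ?_⟩
  rw [← Lp.toLp_coeFn v (Lp.memLp v), Lp.tendsto_Lp_iff_tendsto_eLpNorm''] at hv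
  have h2 := ((ENNReal.continuous_pow 2).tendsto 0).comp hv
  rw [zero_pow two_ne_zero] at h2
  refine h2.congr fun k => ?_
  exact eLpNorm_two_sq μ _

lemma norm_gradient_eq_norm_fderiv {n : ℕ} (u : EuclideanSpace ℝ (Fin n) → ℝ)
    (y : EuclideanSpace ℝ (Fin n)) : ‖gradient u y‖ = ‖fderiv ℝ u y‖ :=
  LinearIsometryEquiv.norm_map _ _

/-- Interior compact (Rellich–Kondrachov) embedding `H¹ ↪↪ L²` for `A₂`-weighted
measures: a sequence of `C¹` functions with `∫_{B(x₀,R)} (u_j² + ‖∇u_j‖²) dμ_ω ≤ 1`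
has a subsequence converging in `L²(B(x₀,R'), μ_ω)` for any `0 < R' < R`. -/
theorem statement16 (n : ℕ) (hn : 1 ≤ n) (ω : EuclideanSpace ℝ (Fin n) → ℝ)
    (hmeas : Measurable ω)
    (hpos : ∀ᵐ x ∂(volume : Measure (EuclideanSpace ℝ (Fin n))), 0 < ω x)
    (C : ℝ≥0) (hA2 : IsA2 n ω (C : ℝ≥0∞))
    (x₀ : EuclideanSpace ℝ (Fin n)) (R R' : ℝ) (hR' : 0 < R') (hRR : R' < R)
    (u : ℕ → EuclideanSpace ℝ (Fin n) → ℝ) (hu : ∀ j, ContDiff ℝ 1 (u j))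
    (hbound : ∀ j,
      (∫⁻ y in ball x₀ R,
          ENNReal.ofReal ((u j y) ^ 2 + ‖gradient (u j) y‖ ^ 2) ∂(muOmega n ω)) ≤ 1) :
    ∃ φ : ℕ → ℕ, StrictMono φ ∧
      ∃ v : EuclideanSpace ℝ (Fin n) → ℝ, Measurable v ∧
        Filter.Tendsto
          (fun l => ∫⁻ y in ball x₀ R',
              ENNReal.ofReal ((u (φ l) y - v y) ^ 2) ∂(muOmega n ω))
          Filter.atTop (nhds 0) := by
  set μ := muOmega n ω with hμ
  have hu2 : ∀ j, ∫⁻ y in ball x₀ R, ‖u j y‖ₑ ^ 2 ∂μ ≤ 1 := fun j => by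
    refine (lintegral_mono fun y => ?_).trans (hbound j)
    rw [← ofReal_norm, ← ENNReal.ofReal_pow (norm_nonneg _), Real.norm_eq_abs, sq_abs]
    exact ENNReal.ofReal_le_ofReal (le_add_of_nonneg_right (sq_nonneg _))
  have hg2 : ∀ j, ∫⁻ y in ball x₀ R, ‖fderiv ℝ (u j) y‖ₑ ^ 2 ∂μ ≤ 1 := fun j => by
    refine (lintegral_mono fun y => ?_).trans (hbound j)
    rw [← ofReal_norm, ← ENNReal.ofReal_pow (norm_nonneg _), norm_gradient_eq_norm_fderiv]
    exact ENNReal.ofReal_le_ofReal (le_add_of_nonneg_left (sq_nonneg _))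
  obtain ⟨M, hM⟩ := hA2.setLIntegral_enorm_le hmeas hpos x₀ (hR'.trans hRR) 1
  choose ε P s hε hfin hs hP H using fun m : ℕ =>
    hA2.exists_finite_averages hmeas hpos x₀ hR' hRR 4 (δ := ((m : ℝ≥0∞))⁻¹) (by simp)
  have hcount : ∀ m, Countable (P m) := fun m => (hfin m).countable.to_subtype
  obtain ⟨φ, a, hφ, ha⟩ := exists_subseq_tendsto_of_bounded
    (fun j (i : Σ m, P m) => ⨍ y in ball (i.2 : EuclideanSpace ℝ (Fin n)) (ε i.1), u j y)
    (fun i => ((M : ℝ≥0∞) / volume (ball (i.2 : EuclideanSpace ℝ (Fin n)) (ε i.1))).toReal) (by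
      rintro j ⟨m, p, hp⟩
      have hV0 : volume (ball p (ε m)) ≠ 0 := (measure_ball_pos _ _ (hε m)).ne'
      rw [← Real.norm_eq_abs, ← toReal_enorm]
      refine ENNReal.toReal_mono (ENNReal.div_ne_top (by simp) hV0) ?_
      rw [ENNReal.le_div_iff_mul_le (Or.inl hV0) (Or.inl measure_ball_lt_top.ne)]
      refine (enorm_setAverage_mul_le (u j) p (hε m)).trans
        ((lintegral_mono_set (hP m p hp)).trans ?_)
      exact hM (u j) (hu j).continuous.measurable (by simpa using hu2 j))
  have hmem : ∀ k, MemLp (u (φ k)) 2 (μ.restrict (ball x₀ R')) := fun k => by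
    refine ⟨(hu _).continuous.aestronglyMeasurable, ?_⟩
    refine (ENNReal.pow_lt_top_iff.1 ?_).resolve_right two_ne_zero
    rw [eLpNorm_two_sq]
    exact ((lintegral_mono_set (ball_subset_ball hRR.le)).trans (hu2 (φ k))).trans_lt
      ENNReal.one_lt_top
  obtain ⟨v, hv, hlim⟩ := exists_tendsto_lintegral_sq (μ.restrict (ball x₀ R')) hmem (by
    intro δ hδ
    obtain ⟨m, hm⟩ := ENNReal.exists_inv_nat_lt hδ.ne'
    have hev : ∀ᶠ k in Filter.atTop, ∀ p : P m,
        |(⨍ y in ball (p : EuclideanSpace ℝ (Fin n)) (ε m), u (φ k) y) - a ⟨m, p⟩| < s m / 2 := by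
      have : Finite (P m) := (hfin m).to_subtype
      refine Filter.eventually_all.2 fun p => ?_
      exact (ha ⟨m, p⟩).eventually (ball_mem_nhds _ (half_pos (hs m)))
    obtain ⟨N, hN⟩ := Filter.eventually_atTop.1 hev
    refine ⟨N, fun k hk l hl => (H m (fun y => u (φ k) y - u (φ l) y)
      ((hu _).sub (hu _)) ?_ ?_ ?_).trans hm.le⟩
    · refine (lintegral_enorm_sub_sq_le _
        (hu (φ k)).continuous.enorm.measurable.aemeasurable).trans ?_
      calc _ ≤ 2 * ((1 : ℝ≥0∞) + 1) := mul_le_mul_right (add_le_add (hu2 _) (hu2 _)) _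
        _ = _ := by norm_num
    · have hfd : ∀ y, fderiv ℝ (fun y => u (φ k) y - u (φ l) y) y
          = fderiv ℝ (u (φ k)) y - fderiv ℝ (u (φ l)) y := fun y =>
        fderiv_fun_sub ((hu _).differentiable one_ne_zero y) ((hu _).differentiable one_ne_zero y)
      simp only [hfd]
      refine (lintegral_enorm_sub_sq_le _
        ((hu (φ k)).continuous_fderiv one_ne_zero).enorm.measurable.aemeasurable).trans ?_
      calc _ ≤ 2 * ((1 : ℝ≥0∞) + 1) := mul_le_mul_right (add_le_add (hg2 _) (hg2 _)) _
        _ = _ := by norm_num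
    · intro p hp
      have hint : ∀ j, IntegrableOn (u j) (ball p (ε m)) := fun j =>
        ((hu j).continuous.continuousOn.integrableOn_compact (isCompact_closedBall p (ε m))).mono_set
          ball_subset_closedBall
      have havg : ⨍ y in ball p (ε m), (u (φ k) y - u (φ l) y)
          = (⨍ y in ball p (ε m), u (φ k) y) - ⨍ y in ball p (ε m), u (φ l) y := by
        simp only [setAverage_eq]
        rw [integral_sub (hint _) (hint _), smul_sub]
      rw [havg]
      have h1 := abs_lt.1 (hN k hk ⟨p, hp⟩)
      have h2 := abs_lt.1 (hN l hl ⟨p, hp⟩)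
      rw [abs_le]
      constructor <;> linarith [h1.1, h1.2, h2.1, h2.2])
  refine ⟨φ, hφ, v, hv, hlim.congr fun k => lintegral_congr fun y => ?_⟩
  rw [← ofReal_norm, ← ENNReal.ofReal_pow (norm_nonneg _), Real.norm_eq_abs, sq_abs]
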